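/- Let α ∈ (0,1) and β ∈ (α,1). Then for every continuously differentiable function u : [0,1] → ℝ with u(0) = 0 one has ∫_0^1 r^{α-2} u(r)² dr ≤ (1/((1-β)(β-α))) ∫_0^1 r^α u'(r)² dr. -/

import Mathlib

open MeasureTheory Set

/-- A function that is continuous and bounded on `(0,1)` is integrable there. -/
lemma integrableOn_Ioo_of_continuousOn_of_bounded {f : ℝ → ℝ} {C : ℝ}
    (hf : ContinuousOn f (Ioo (0:ℝ) 1)) (hC : ∀ r ∈ Ioo (0:ℝ) 1, |f r| ≤ C) :
    IntegrableOn f (Ioo (0:ℝ) 1) :=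
  IntegrableOn.of_bound (by simp) (hf.aestronglyMeasurable measurableSet_Ioo) C
    ((ae_restrict_iff' measurableSet_Ioo).2 (Filter.Eventually.of_forall hC))

/-- A `C¹` function on `[0,1]` vanishing at `0` has derivative bounded by some `M` and is
bounded by `M r`. -/
lemma exists_derivWithin_bound_and_linear_bound {u : ℝ → ℝ}
    (hu : ContDiffOn ℝ 1 u (Icc (0:ℝ) 1)) (h0 : u 0 = 0) :
    ∃ M, 0 ≤ M ∧ (∀ r ∈ Icc (0:ℝ) 1, |derivWithin u (Icc 0 1) r| ≤ M) ∧
      ∀ r ∈ Icc (0:ℝ) 1, |u r| ≤ M * r := by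
  have hw : ContinuousOn (derivWithin u (Icc 0 1)) (Icc (0:ℝ) 1) :=
    hu.continuousOn_derivWithin (uniqueDiffOn_Icc one_pos) le_rfl
  obtain ⟨M, hM⟩ := isCompact_Icc.exists_bound_of_continuousOn hw
  have hzero : (0:ℝ) ∈ Icc (0:ℝ) 1 := by simp
  refine ⟨M, (norm_nonneg _).trans (hM 0 hzero), hM, fun r hr => ?_⟩
  have := (convex_Icc (0:ℝ) 1).norm_image_sub_le_of_norm_derivWithin_le
    (hu.differentiableOn one_ne_zero) hM hzero hr
  simpa [h0, abs_of_nonneg hr.1] using this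

/-- If `|u r| ≤ M r` on `[0,1]` and `α > -1`, then `r ^ (α - 1) * u r ^ 2` extends continuously
to `0`. -/
lemma continuousOn_rpow_mul_sq_of_linear_bound {α M : ℝ} (hα : -1 < α) {u : ℝ → ℝ}
    (hu : ContinuousOn u (Icc (0:ℝ) 1)) (hM : ∀ r ∈ Icc (0:ℝ) 1, |u r| ≤ M * r) :
    ContinuousOn (fun r => r ^ (α - 1) * (u r) ^ 2) (Icc (0:ℝ) 1) := by
  intro r hr
  rcases hr.1.eq_or_lt with rfl | hpos
  · have hu0 : u 0 = 0 := by simpa using hM 0 hr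
    have hlim : Filter.Tendsto (fun r : ℝ => M ^ 2 * r ^ (α + 1)) (nhdsWithin 0 (Icc 0 1))
        (nhds 0) := by
      have h : ContinuousAt (fun r : ℝ => M ^ 2 * r ^ (α + 1)) 0 :=
        continuousAt_const.mul (Real.continuousAt_rpow_const _ _ (Or.inr (by linarith)))
      have h' := h.tendsto
      rw [Real.zero_rpow (by linarith), mul_zero] at h'
      exact h'.mono_left nhdsWithin_le_nhds
    simp only [ContinuousWithinAt, hu0, ne_eq, OfNat.ofNat_ne_zero, not_false_eq_true, zero_pow,
      mul_zero]
    refine squeeze_zero' ?_ ?_ hlim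
    · filter_upwards [self_mem_nhdsWithin] with s hs
      have := Real.rpow_nonneg hs.1 (α - 1)
      positivity
    · filter_upwards [self_mem_nhdsWithin] with s hs
      rcases hs.1.eq_or_lt with rfl | hs0
      · simp [hu0, Real.zero_rpow (show α + 1 ≠ 0 by linarith)]
      · have hsq : u s ^ 2 ≤ (M * s) ^ 2 := sq_le_sq' (abs_le.1 (hM s hs)).1 (abs_le.1 (hM s hs)).2
        have he : s ^ (α + 1) = s ^ (α - 1) * s ^ 2 := by
          rw [← Real.rpow_natCast, ← Real.rpow_add hs0]
          congr 1
          push_cast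
          ring
        calc s ^ (α - 1) * u s ^ 2 ≤ s ^ (α - 1) * (M * s) ^ 2 := by gcongr
          _ = M ^ 2 * s ^ (α + 1) := by rw [he]; ring
  · exact (Real.continuousAt_rpow_const _ _ (Or.inl hpos.ne')).continuousWithinAt.mul
      ((hu r hr).pow 2)

/-- One-dimensional slice Hardy estimate with interpolation parameter β ∈ (α,1):
for C¹ functions u on [0,1] with u(0) = 0,
∫_0^1 r^{α-2} u(r)² dr ≤ (1/((1-β)(β-α))) ∫_0^1 r^α u'(r)² dr. -/
theorem one_dim_hardy_slice (α β : ℝ) (hα : α ∈ Ioo (0:ℝ) 1) (hβ : β ∈ Ioo α 1)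
    (u : ℝ → ℝ) (hu : ContDiffOn ℝ 1 u (Icc (0:ℝ) 1)) (h0 : u 0 = 0) :
    ∫ r in Ioo (0:ℝ) 1, r ^ (α - 2) * (u r) ^ 2
      ≤ (1 / ((1 - β) * (β - α))) * ∫ r in Ioo (0:ℝ) 1, r ^ α * (deriv u r) ^ 2 := by
  obtain ⟨M, hM0, hMw, hMu⟩ := exists_derivWithin_bound_and_linear_bound hu h0
  have hα0 : 0 < α := hα.1
  have hb1 : 0 < 1 - β := sub_pos.2 hβ.2
  have hb2 : 0 < β - α := sub_pos.2 hβ.1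
  have hderiv : ∀ r ∈ Ioo (0:ℝ) 1, HasDerivAt u (deriv u r) r := fun r hr =>
    ((hu.differentiableOn one_ne_zero).differentiableAt (Icc_mem_nhds hr.1 hr.2)).hasDerivAt
  have hdu : ∀ r ∈ Ioo (0:ℝ) 1, derivWithin u (Icc 0 1) r = deriv u r := fun r hr =>
    derivWithin_of_mem_nhds (Icc_mem_nhds hr.1 hr.2)
  have hMd : ∀ r ∈ Ioo (0:ℝ) 1, |deriv u r| ≤ M := fun r hr =>
    hdu r hr ▸ hMw r (Ioo_subset_Icc_self hr)
  have hcd : ContinuousOn (deriv u) (Ioo (0:ℝ) 1) :=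
    ((hu.continuousOn_derivWithin (uniqueDiffOn_Icc one_pos) le_rfl).mono
      Ioo_subset_Icc_self).congr fun r hr => (hdu r hr).symm
  have hcu : ContinuousOn u (Ioo (0:ℝ) 1) := hu.continuousOn.mono Ioo_subset_Icc_self
  have hcr : ∀ s : ℝ, ContinuousOn (fun r : ℝ => r ^ s) (Ioo (0:ℝ) 1) := fun s r hr =>
    (Real.continuousAt_rpow_const _ _ (Or.inl hr.1.ne')).continuousWithinAt
  have hpow1 : ∀ r ∈ Ioo (0:ℝ) 1, r ^ (α - 1) = r ^ (α - 2) * r := fun r hr => by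
    rw [← Real.rpow_add_one hr.1.ne']
    congr 1
    ring
  have hpow2 : ∀ r ∈ Ioo (0:ℝ) 1, r ^ α = r ^ (α - 2) * r ^ 2 := fun r hr => by
    rw [← Real.rpow_natCast, ← Real.rpow_add hr.1]
    congr 1
    push_cast
    ring
  have hle1 : ∀ r ∈ Ioo (0:ℝ) 1, r ^ (α - 2) * r ^ 2 ≤ 1 := fun r hr =>
    hpow2 r hr ▸ Real.rpow_le_one hr.1.le hr.2.le hα0.le
  have hA : IntegrableOn (fun r => r ^ (α - 2) * (u r) ^ 2) (Ioo (0:ℝ) 1) := by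
    refine integrableOn_Ioo_of_continuousOn_of_bounded (C := M ^ 2) ((hcr _).mul (hcu.pow 2))
      fun r hr => ?_
    have hp := Real.rpow_pos_of_pos hr.1 (α - 2)
    rw [abs_mul, abs_pow, abs_of_pos hp]
    calc r ^ (α - 2) * |u r| ^ 2 ≤ r ^ (α - 2) * (M * r) ^ 2 := by
          gcongr
          exact hMu r (Ioo_subset_Icc_self hr)
      _ = M ^ 2 * (r ^ (α - 2) * r ^ 2) := by ring
      _ ≤ M ^ 2 := mul_le_of_le_one_right (sq_nonneg M) (hle1 r hr)
  have hB : IntegrableOn (fun r => r ^ (α - 1) * (u r * deriv u r)) (Ioo (0:ℝ) 1) := by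
    refine integrableOn_Ioo_of_continuousOn_of_bounded (C := M ^ 2) ((hcr _).mul (hcu.mul hcd))
      fun r hr => ?_
    have hp := Real.rpow_pos_of_pos hr.1 (α - 2)
    have hr0 := hr.1
    rw [hpow1 r hr, abs_mul, abs_mul (u r), abs_of_pos (mul_pos hp hr0)]
    calc r ^ (α - 2) * r * (|u r| * |deriv u r|) ≤ r ^ (α - 2) * r * ((M * r) * M) := by
          gcongr
          · exact hMu r (Ioo_subset_Icc_self hr)
          · exact hMd r hr
      _ = M ^ 2 * (r ^ (α - 2) * r ^ 2) := by ring
      _ ≤ M ^ 2 := mul_le_of_le_one_right (sq_nonneg M) (hle1 r hr)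
  have hC : IntegrableOn (fun r => r ^ α * (deriv u r) ^ 2) (Ioo (0:ℝ) 1) := by
    refine integrableOn_Ioo_of_continuousOn_of_bounded (C := M ^ 2) ((hcr _).mul (hcd.pow 2))
      fun r hr => ?_
    have hp := Real.rpow_pos_of_pos hr.1 α
    rw [abs_mul, abs_pow, abs_of_pos hp]
    calc r ^ α * |deriv u r| ^ 2 ≤ 1 * M ^ 2 := by
          gcongr
          · exact Real.rpow_le_one hr.1.le hr.2.le hα0.le
          · exact hMd r hr
      _ = M ^ 2 := one_mul _
  set g : ℝ → ℝ := fun r =>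
    (α - 1) * (r ^ (α - 2) * (u r) ^ 2) + 2 * (r ^ (α - 1) * (u r * deriv u r)) with hg
  have hgi : IntegrableOn g (Ioo (0:ℝ) 1) := (hA.const_mul _).add (hB.const_mul _)
  have hftc : ∫ r in Ioo (0:ℝ) 1, g r = (u 1) ^ 2 := by
    rw [← integral_Ioc_eq_integral_Ioo, ← intervalIntegral.integral_of_le zero_le_one,
      intervalIntegral.integral_eq_sub_of_hasDerivAt_of_le zero_le_one
        (continuousOn_rpow_mul_sq_of_linear_bound (α := α) (by linarith) hu.continuousOn hMu)
        (fun r hr => ?_)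
        ((intervalIntegrable_iff_integrableOn_Ioo_of_le zero_le_one).2 hgi)]
    · simp [h0]
    · have h := (Real.hasDerivAt_rpow_const (p := α - 1) (Or.inl hr.1.ne')).mul
        ((hderiv r hr).pow 2)
      refine h.congr_deriv ?_
      rw [hg, show α - 1 - 1 = α - 2 by ring]
      simp only [Pi.pow_apply]
      push_cast
      ring
  have hmono : ∫ r in Ioo (0:ℝ) 1, g r ≤ ∫ r in Ioo (0:ℝ) 1,
      (1 / (1 - β) * (r ^ α * (deriv u r) ^ 2) - (β - α) * (r ^ (α - 2) * (u r) ^ 2)) := by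
    refine setIntegral_mono_on hgi ((hC.const_mul _).sub (hA.const_mul _)) measurableSet_Ioo
      fun r hr => ?_
    have hp := Real.rpow_pos_of_pos hr.1 (α - 2)
    have hsq : 0 ≤ r ^ (α - 2) * (((1 - β) * u r - r * deriv u r) ^ 2 / (1 - β)) := by positivity
    have he : r ^ (α - 2) * (((1 - β) * u r - r * deriv u r) ^ 2 / (1 - β)) =
        1 / (1 - β) * (r ^ α * (deriv u r) ^ 2) - (β - α) * (r ^ (α - 2) * (u r) ^ 2) - g r := by
      simp only [hg]
      rw [hpow1 r hr, hpow2 r hr]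
      field_simp
      ring
    linarith
  rw [hftc, integral_sub (hC.const_mul _) (hA.const_mul _), integral_const_mul,
    integral_const_mul] at hmono
  have hfin := (sq_nonneg (u 1)).trans hmono
  rw [one_div_mul_eq_div] at hfin ⊢
  rw [← div_div, le_div_iff₀ hb2]
  linarith
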